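/- Entropy-transfer intertwining estimate (the 2ε bound): let I_A : ℂ^{d_A} → ℂ^{d_Ã} ⊗ ℂ^{d_auxA} and I_F : ℂ^{d_F} → ℂ^{d_F̃} ⊗ ℂ^{d_auxF} be isometries, let ψ ∈ ℂ^{d_A} ⊗ ℂ^{d_F} and φ ∈ ℂ^{d_Ã} ⊗ ℂ^{d_F̃} be unit vectors, let aux ∈ ℂ^{d_auxA} ⊗ ℂ^{d_auxF} be a unit vector, and let M on ℂ^{d_A} and M̃ on ℂ^{d_Ã} satisfy ‖M‖ ≤ 1 and ‖M̃‖ ≤ 1. Assume (with tensor factors appropriately reordered) that ‖(I_A ⊗ I_F)(M ⊗ 1_F)ψ − ((M̃ ⊗ 1_F̃)φ) ⊗ aux‖ ≤ ε and ‖(I_A ⊗ I_F)ψ − φ ⊗ aux‖ ≤ ε. Then ‖((I_A M − (M̃ ⊗ 1_auxA) I_A) ⊗ 1_F)ψ‖ ≤ 2ε. -/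

import Mathlib

open scoped Matrix Kronecker

/-- The operator norm (largest singular value) of a square complex matrix. -/
noncomputable def opNorm {n : Type*} [Fintype n] [DecidableEq n]
    (M : Matrix n n ℂ) : ℝ := ‖Matrix.toEuclideanCLM (𝕜 := ℂ) (n := n) M‖

/-- The Euclidean (ℓ²) norm of a finitely-indexed complex vector. -/
noncomputable def l2norm {ι : Type*} [Fintype ι] (v : ι → ℂ) : ℝ :=
  Real.sqrt (∑ i, Complex.normSq (v i))

/-- The tensor product of two vectors. -/
def tensorVec {ι κ : Type*} (u : ι → ℂ) (v : κ → ℂ) : ι × κ → ℂ :=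
  fun p => u p.1 * v p.2

/-- Reordering of tensor factors `(α ⊗ β) ⊗ (γ ⊗ δ) → (α ⊗ γ) ⊗ (β ⊗ δ)` on vectors. -/
def reorderVec {α β γ δ : Type*} (v : (α × β) × (γ × δ) → ℂ) :
    (α × γ) × (β × δ) → ℂ :=
  fun p => v ((p.1.1, p.2.1), (p.1.2, p.2.2))

theorem l2norm_eq_norm_toLp {ι : Type*} [Fintype ι] (v : ι → ℂ) :
    l2norm v = ‖WithLp.toLp 2 v‖ := by
  simp [l2norm, EuclideanSpace.norm_eq, Complex.normSq_eq_norm_sq]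

theorem l2norm_sub_le {ι : Type*} [Fintype ι] (u v : ι → ℂ) :
    l2norm (u - v) ≤ l2norm u + l2norm v := by
  simpa only [l2norm_eq_norm_toLp, WithLp.toLp_sub] using
    norm_sub_le (WithLp.toLp 2 u) (WithLp.toLp 2 v)

theorem sum_normSq_mulVec_le {n : Type*} [Fintype n] [DecidableEq n] {A : Matrix n n ℂ}
    (hA : opNorm A ≤ 1) (v : n → ℂ) :
    ∑ i, Complex.normSq ((A *ᵥ v) i) ≤ ∑ i, Complex.normSq (v i) := by
  have h : l2norm (A *ᵥ v) ≤ l2norm v := by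
    rw [l2norm_eq_norm_toLp, l2norm_eq_norm_toLp, ← Matrix.toEuclideanCLM_toLp]
    exact ((Matrix.toEuclideanCLM (𝕜 := ℂ) (n := n) A).le_of_opNorm_le hA _).trans_eq (one_mul _)
  exact (Real.sqrt_le_sqrt_iff (Finset.sum_nonneg fun i _ => Complex.normSq_nonneg _)).1 h

theorem kronecker_one_mulVec_apply {m n κ : Type*} [Fintype n] [Fintype κ] [DecidableEq κ]
    (A : Matrix m n ℂ) (v : n × κ → ℂ) (i : m) (k : κ) :
    ((A ⊗ₖ (1 : Matrix κ κ ℂ)) *ᵥ v) (i, k) = (A *ᵥ fun j => v (j, k)) i := by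
  simp [Matrix.mulVec, dotProduct, Fintype.sum_prod_type, Matrix.one_apply]

theorem sum_normSq_kronecker_one_mulVec_le {n κ : Type*} [Fintype n] [Fintype κ] [DecidableEq κ]
    {A : Matrix n n ℂ}
    (hA : ∀ v : n → ℂ, ∑ i, Complex.normSq ((A *ᵥ v) i) ≤ ∑ i, Complex.normSq (v i))
    (v : n × κ → ℂ) :
    ∑ p, Complex.normSq (((A ⊗ₖ (1 : Matrix κ κ ℂ)) *ᵥ v) p) ≤ ∑ p, Complex.normSq (v p) := by
  simp only [Fintype.sum_prod_type_right, kronecker_one_mulVec_apply]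
  exact Finset.sum_le_sum fun k _ => hA fun j => v (j, k)

theorem l2norm_mulVec_of_conjTranspose_mul_self {m n : Type*} [Fintype m] [Fintype n]
    [DecidableEq n] {A : Matrix m n ℂ} (hA : Aᴴ * A = 1) (v : n → ℂ) :
    l2norm (A *ᵥ v) = l2norm v := by
  have h : ∑ i, Complex.normSq ((A *ᵥ v) i) = ∑ i, Complex.normSq (v i) := by
    apply Complex.ofReal_injective
    simp only [Complex.ofReal_sum, Complex.normSq_eq_conj_mul_self]
    change star (A *ᵥ v) ⬝ᵥ (A *ᵥ v) = star v ⬝ᵥ v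
    rw [Matrix.star_mulVec, Matrix.dotProduct_mulVec, Matrix.vecMul_vecMul, hA, Matrix.vecMul_one]
  rw [l2norm, l2norm, h]

theorem kronecker_one_mulVec_reorderVec_tensorVec {α β γ δ : Type*} [Fintype α] [Fintype β]
    [Fintype γ] [Fintype δ] [DecidableEq β] [DecidableEq γ] [DecidableEq δ]
    (A : Matrix α α ℂ) (u : α × β → ℂ) (w : γ × δ → ℂ) :
    ((A ⊗ₖ (1 : Matrix γ γ ℂ)) ⊗ₖ (1 : Matrix (β × δ) (β × δ) ℂ)) *ᵥ reorderVec (tensorVec u w) =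
      reorderVec (tensorVec ((A ⊗ₖ (1 : Matrix β β ℂ)) *ᵥ u) w) := by
  ext ⟨⟨a, c⟩, b, d⟩
  rw [kronecker_one_mulVec_apply, kronecker_one_mulVec_apply]
  simp only [reorderVec, tensorVec, kronecker_one_mulVec_apply]
  simp only [Matrix.mulVec, dotProduct, Finset.sum_mul, mul_assoc]

/-- **Entropy-transfer intertwining estimate (the 2ε bound).** If `(I_A ⊗ I_F)`
ε-intertwines `(M ⊗ 1)ψ` with `((M̃ ⊗ 1)φ) ⊗ aux` and `ψ` with `φ ⊗ aux`, then
`‖((I_A M − (M̃ ⊗ 1_auxA) I_A) ⊗ 1_F)ψ‖ ≤ 2ε`. -/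
theorem entropy_transfer_two_eps_bound {dA dF dAt dFt dauxA dauxF : ℕ}
    (IA : Matrix (Fin dAt × Fin dauxA) (Fin dA) ℂ) (hIA : IAᴴ * IA = 1)
    (IF : Matrix (Fin dFt × Fin dauxF) (Fin dF) ℂ) (hIF : IFᴴ * IF = 1)
    (ψ : Fin dA × Fin dF → ℂ) (hψ : ∑ i, Complex.normSq (ψ i) = 1)
    (φ : Fin dAt × Fin dFt → ℂ) (hφ : ∑ i, Complex.normSq (φ i) = 1)
    (aux : Fin dauxA × Fin dauxF → ℂ) (haux : ∑ i, Complex.normSq (aux i) = 1)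
    (M : Matrix (Fin dA) (Fin dA) ℂ) (hM : opNorm M ≤ 1)
    (Mt : Matrix (Fin dAt) (Fin dAt) ℂ) (hMt : opNorm Mt ≤ 1)
    (ε : ℝ) (hε : 0 ≤ ε)
    (h1 : l2norm ((IA ⊗ₖ IF) *ᵥ ((M ⊗ₖ (1 : Matrix (Fin dF) (Fin dF) ℂ)) *ᵥ ψ) -
      reorderVec (tensorVec ((Mt ⊗ₖ (1 : Matrix (Fin dFt) (Fin dFt) ℂ)) *ᵥ φ) aux)) ≤ ε)
    (h2 : l2norm ((IA ⊗ₖ IF) *ᵥ ψ - reorderVec (tensorVec φ aux)) ≤ ε) :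
    l2norm (((IA * M - (Mt ⊗ₖ (1 : Matrix (Fin dauxA) (Fin dauxA) ℂ)) * IA) ⊗ₖ
      (1 : Matrix (Fin dF) (Fin dF) ℂ)) *ᵥ ψ) ≤ 2 * ε := by
  have hiso : ((1 : Matrix (Fin dAt × Fin dauxA) (Fin dAt × Fin dauxA) ℂ) ⊗ₖ IF)ᴴ *
      ((1 : Matrix (Fin dAt × Fin dauxA) (Fin dAt × Fin dauxA) ℂ) ⊗ₖ IF) = 1 := by
    rw [Matrix.conjTranspose_kronecker, ← Matrix.mul_kronecker_mul, hIF, Matrix.conjTranspose_one,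
      one_mul, Matrix.one_kronecker_one]
  have hsplit : ((1 : Matrix (Fin dAt × Fin dauxA) (Fin dAt × Fin dauxA) ℂ) ⊗ₖ IF) *ᵥ
      (((IA * M - (Mt ⊗ₖ (1 : Matrix (Fin dauxA) (Fin dauxA) ℂ)) * IA) ⊗ₖ
        (1 : Matrix (Fin dF) (Fin dF) ℂ)) *ᵥ ψ) =
      ((IA ⊗ₖ IF) *ᵥ ((M ⊗ₖ (1 : Matrix (Fin dF) (Fin dF) ℂ)) *ᵥ ψ) -
        reorderVec (tensorVec ((Mt ⊗ₖ (1 : Matrix (Fin dFt) (Fin dFt) ℂ)) *ᵥ φ) aux)) -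
      ((Mt ⊗ₖ (1 : Matrix (Fin dauxA) (Fin dauxA) ℂ)) ⊗ₖ
        (1 : Matrix (Fin dFt × Fin dauxF) (Fin dFt × Fin dauxF) ℂ)) *ᵥ
        ((IA ⊗ₖ IF) *ᵥ ψ - reorderVec (tensorVec φ aux)) := by
    have hsub (B C : Matrix (Fin dAt × Fin dauxA) (Fin dA) ℂ) :
        (B - C) ⊗ₖ IF = B ⊗ₖ IF - C ⊗ₖ IF := by
      ext; simp [sub_mul]
    rw [Matrix.mulVec_sub, kronecker_one_mulVec_reorderVec_tensorVec, sub_sub_sub_cancel_right]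
    simp only [Matrix.mulVec_mulVec, ← Matrix.mul_kronecker_mul, Matrix.one_mul,
      Matrix.mul_one, hsub, Matrix.sub_mulVec]
  rw [← l2norm_mulVec_of_conjTranspose_mul_self hiso, hsplit, two_mul]
  refine (l2norm_sub_le _ _).trans (add_le_add h1 (le_trans ?_ h2))
  exact Real.sqrt_le_sqrt (sum_normSq_kronecker_one_mulVec_le
    (sum_normSq_kronecker_one_mulVec_le (sum_normSq_mulVec_le hMt)) _)
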